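/- arXiv:hep-th/9408177 — 6 statements merged into one kernel-verified Lean document; each statement's English description precedes it below -/
import Mathlib

section
/- Let R be a universal R-matrix for A and let u = m((S ⊗ id)(τ(R))) be the Drinfeld element. Then u is a unit of A, with inverse u⁻¹ = m((id ⊗ S∘S)(τ(R))); that is, writing R = Σ_t α_t ⊗ β_t, the elements u = Σ_t S(β_t)·α_t and u' = Σ_t β_t·S(S(α_t)) satisfy u·u' = u'·u = 1. -/
open TensorProduct LinearMap

noncomputable section

variable (k : Type*) [Field k] (A : Type*) [Ring A] [HopfAlgebra k A]

/-- The embedding `a ⊗ b ↦ a ⊗ b ⊗ 1` of `A ⊗ A` into positions `1,2` of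
`A ⊗ A ⊗ A`, so that `R₁₂ = emb12 R = R ⊗ 1`. -/
def emb12 : A ⊗[k] A →ₗ[k] A ⊗[k] (A ⊗[k] A) :=
  lTensor A ((TensorProduct.mk k A A).flip 1)

/-- The embedding `a ⊗ b ↦ a ⊗ 1 ⊗ b` of `A ⊗ A` into positions `1,3` of
`A ⊗ A ⊗ A`, so that `R₁₃ = emb13 R = (id ⊗ τ)(R ⊗ 1)`. -/
def emb13 : A ⊗[k] A →ₗ[k] A ⊗[k] (A ⊗[k] A) :=
  lTensor A (TensorProduct.mk k A A 1)

/-- The embedding `x ↦ 1 ⊗ x` of `A ⊗ A` into positions `2,3` of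
`A ⊗ A ⊗ A`, so that `R₂₃ = emb23 R = 1 ⊗ R`. -/
def emb23 : A ⊗[k] A →ₗ[k] A ⊗[k] (A ⊗[k] A) :=
  TensorProduct.mk k A (A ⊗[k] A) 1

/-- `R ∈ A ⊗ A` is a universal R-matrix (making `(A, R)` quasitriangular):
`R` is invertible in the algebra `A ⊗ A`, `R·Δ(a) = (τ∘Δ)(a)·R` for all `a`,
`(Δ ⊗ id)(R) = R₁₃·R₂₃` and `(id ⊗ Δ)(R) = R₁₃·R₁₂`. -/
structure IsUniversalRMatrix (R : A ⊗[k] A) : Prop where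
  isUnit : IsUnit R
  comm_comul : ∀ a : A,
    R * Coalgebra.comul (R := k) a
      = (TensorProduct.comm k A A) (Coalgebra.comul (R := k) a) * R
  comul_tensor_id : (TensorProduct.assoc k A A A)
      (rTensor A (Coalgebra.comul (R := k) (A := A)) R)
      = emb13 k A R * emb23 k A R
  id_tensor_comul : lTensor A (Coalgebra.comul (R := k) (A := A)) R
      = emb13 k A R * emb12 k A R

/-- The Drinfeld element `u = m((S ⊗ id)(τ(R))) = Σ_t S(β_t)·α_t` for
`R = Σ_t α_t ⊗ β_t`. -/
def drinfeldU (R : A ⊗[k] A) : A :=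
  LinearMap.mul' k A
    (rTensor A (HopfAlgebra.antipode (R := k)) ((TensorProduct.comm k A A) R))

/-- The candidate inverse `u' = m((id ⊗ S∘S)(τ(R))) = Σ_t β_t·S(S(α_t))`. -/
def drinfeldU' (R : A ⊗[k] A) : A :=
  LinearMap.mul' k A
    (lTensor A ((HopfAlgebra.antipode (R := k)) ∘ₗ (HopfAlgebra.antipode (R := k)))
      ((TensorProduct.comm k A A) R))

/-- The linear map `a ⊗ b ↦ b * c * a`. -/
def sandwich (c : A) : A ⊗[k] A →ₗ[k] A :=
  mul' k A ∘ₗ rTensor A (mulRight k c) ∘ₗ (TensorProduct.comm k A A).toLinearMap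

@[simp]
theorem sandwich_tmul (c a b : A) : sandwich k A c (a ⊗ₜ b) = b * c * a := by
  simp [sandwich]

theorem sandwich_add (c d : A) (X : A ⊗[k] A) :
    sandwich k A (c + d) X = sandwich k A c X + sandwich k A d X := by
  induction X with
  | zero => simp
  | tmul a b => simp [mul_add, add_mul]
  | add X Y hX hY => simp only [map_add, hX, hY]; abel

theorem sandwich_smul (r : k) (c : A) (X : A ⊗[k] A) :
    sandwich k A (r • c) X = r • sandwich k A c X := by
  induction X with
  | zero => simp
  | tmul a b => simp
  | add X Y hX hY => simp only [map_add, hX, hY, smul_add]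

theorem sandwich_zero (X : A ⊗[k] A) : sandwich k A 0 X = 0 := by
  simpa using sandwich_smul k A 0 0 X

/-- The linear map `a ⊗ b ↦ S(b) * c * a`. -/
def antipodeSandwich (c : A) : A ⊗[k] A →ₗ[k] A :=
  sandwich k A c ∘ₗ lTensor A (HopfAlgebra.antipode k)

@[simp]
theorem antipodeSandwich_tmul (c a b : A) :
    antipodeSandwich k A c (a ⊗ₜ b) = HopfAlgebra.antipode k b * c * a := by
  simp [antipodeSandwich]

/-- The maps `antipodeSandwich` form a right action of `A ⊗ A` on `A`. -/
theorem antipodeSandwich_mul (c : A) (X Y : A ⊗[k] A) :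
    antipodeSandwich k A c (X * Y) =
      antipodeSandwich k A (antipodeSandwich k A c X) Y := by
  induction X with
  | zero => simp [antipodeSandwich, sandwich_zero]
  | add X X' hX hX' =>
    simp only [add_mul, map_add, hX, hX']
    simp [antipodeSandwich, sandwich_add]
  | tmul a b =>
    induction Y with
    | zero => simp
    | add Y Y' hY hY' => simp only [mul_add, map_add, hY, hY']
    | tmul a' b' => simp [HopfAlgebra.antipode_mul_antidistrib, mul_assoc]

theorem antipodeSandwich_smul (r : k) (c : A) (X : A ⊗[k] A) :
    antipodeSandwich k A (r • c) X = r • antipodeSandwich k A c X :=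
  sandwich_smul k A r c _

theorem drinfeldU_eq_antipodeSandwich (R : A ⊗[k] A) :
    drinfeldU k A R = antipodeSandwich k A 1 R := by
  induction R with
  | zero => simp [drinfeldU]
  | tmul a b => simp [drinfeldU]
  | add X Y hX hY => simpa [drinfeldU] using congr($hX + $hY)

theorem drinfeldU'_eq_sandwich (R : A ⊗[k] A) :
    drinfeldU' k A R = sandwich k A 1
      (rTensor A (HopfAlgebra.antipode k ∘ₗ HopfAlgebra.antipode k) R) := by
  induction R with
  | zero => simp [drinfeldU']
  | tmul a b => simp [drinfeldU']
  | add X Y hX hY => simpa [drinfeldU'] using congr($hX + $hY)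

theorem antipodeSandwich_one_comm_comul (a : A) :
    antipodeSandwich k A 1 (TensorProduct.comm k A A (Coalgebra.comul a)) =
      Coalgebra.counit (R := k) a • 1 := by
  have h (X : A ⊗[k] A) : antipodeSandwich k A 1 (TensorProduct.comm k A A X) =
      mul' k A (rTensor A (HopfAlgebra.antipode k) X) := by
    induction X with
    | zero => simp
    | tmul a b => simp
    | add X Y hX hY => simp only [map_add, hX, hY]
  rw [h, HopfAlgebra.mul_antipode_rTensor_comul_apply, Algebra.algebraMap_eq_smul_one]

/-- If `R Δ(a) = Δᵒᵖ(a) R` for all `a`, then `Σ S(a₂) u a₁ = ε(a) u`. -/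
theorem antipodeSandwich_drinfeldU_comul {R : A ⊗[k] A}
    (hR : ∀ a : A, R * Coalgebra.comul (R := k) a
      = (TensorProduct.comm k A A) (Coalgebra.comul (R := k) a) * R) (a : A) :
    antipodeSandwich k A (drinfeldU k A R) (Coalgebra.comul a) =
      Coalgebra.counit (R := k) a • drinfeldU k A R := by
  rw [drinfeldU_eq_antipodeSandwich, ← antipodeSandwich_mul, hR, antipodeSandwich_mul,
    antipodeSandwich_one_comm_comul, antipodeSandwich_smul]

/-- If `Σ S(a₂) u a₁ = ε(a) u` for all `a`, then `u` implements `S²`. -/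
theorem mul_eq_antipode_antipode_mul {u : A}
    (hu : ∀ a : A, antipodeSandwich k A u (Coalgebra.comul a) =
      Coalgebra.counit (R := k) a • u) (a : A) :
    u * a = HopfAlgebra.antipode k (HopfAlgebra.antipode k a) * u := by
  let T : A →ₗ[k] A := HopfAlgebra.antipode k ∘ₗ HopfAlgebra.antipode k
  let G : (A ⊗[k] A) ⊗[k] A →ₗ[k] A :=
    sandwich k A 1 ∘ₗ TensorProduct.map (antipodeSandwich k A u) T
  have left (X : A ⊗[k] A) : G (rTensor A (Coalgebra.comul (R := k)) X) =
      sandwich k A u (TensorProduct.map (Algebra.linearMap k A ∘ₗ Coalgebra.counit) T X) := by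
    induction X with
    | zero => simp
    | tmul a b => simp [G, hu, Algebra.algebraMap_eq_smul_one]
    | add X Y hX hY => simp only [map_add, hX, hY]
  have inner (a : A) (D : A ⊗[k] A) : G ((TensorProduct.assoc k A A A).symm (a ⊗ₜ D)) =
      HopfAlgebra.antipode k (mul' k A (lTensor A (HopfAlgebra.antipode k) D)) * u * a := by
    induction D with
    | zero => simp
    | tmul b c => simp [G, T, HopfAlgebra.antipode_mul_antidistrib, mul_assoc]
    | add X Y hX hY => simp only [TensorProduct.tmul_add, map_add, hX, hY, add_mul]
  have right (X : A ⊗[k] A) :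
      G ((TensorProduct.assoc k A A A).symm (lTensor A (Coalgebra.comul (R := k)) X)) =
      sandwich k A u (lTensor A (Algebra.linearMap k A ∘ₗ Coalgebra.counit) X) := by
    induction X with
    | zero => simp
    | tmul a b => simp [inner, Algebra.algebraMap_eq_smul_one]
    | add X Y hX hY => simp only [map_add, hX, hY]
  have key := left (Coalgebra.comul a)
  rw [← Coalgebra.coassoc_symm_apply, right, lTensor_comp_apply,
    Coalgebra.lTensor_counit_comul] at key
  have e : TensorProduct.map (Algebra.linearMap k A ∘ₗ Coalgebra.counit (R := k) (A := A)) T =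
      TensorProduct.map (Algebra.linearMap k A) T ∘ₗ
        rTensor A (Coalgebra.counit (R := k) (A := A)) := by
    ext; simp
  rw [e, LinearMap.comp_apply, Coalgebra.rTensor_counit_comul] at key
  simpa [T] using key

/-- The linear map `ε ⊗ id : A ⊗ A → A`. -/
def counitLeft : A ⊗[k] A →ₗ[k] A :=
  (TensorProduct.lid k A).toLinearMap ∘ₗ rTensor A Coalgebra.counit

/-- The linear map `id ⊗ ε : A ⊗ A → A`. -/
def counitRight : A ⊗[k] A →ₗ[k] A :=
  (TensorProduct.rid k A).toLinearMap ∘ₗ lTensor A Coalgebra.counit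

variable {k A}

theorem IsUniversalRMatrix.counitLeft_eq_one {R : A ⊗[k] A} (hR : IsUniversalRMatrix k A R) :
    counitLeft k A R = 1 := by
  let F : A ⊗[k] (A ⊗[k] A) →ₗ[k] A ⊗[k] A :=
    (TensorProduct.lid k (A ⊗[k] A)).toLinearMap ∘ₗ rTensor (A ⊗[k] A) Coalgebra.counit
  have comul (X : A ⊗[k] A) :
      F (TensorProduct.assoc k A A A (rTensor A (Coalgebra.comul (R := k)) X)) = X := by
    have h (D : A ⊗[k] A) (b : A) :
        F (TensorProduct.assoc k A A A (D ⊗ₜ b)) = counitLeft k A D ⊗ₜ b := by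
      induction D with
      | zero => simp
      | tmul a c => simp [F, counitLeft, TensorProduct.smul_tmul']
      | add X Y hX hY => simp only [TensorProduct.add_tmul, map_add, hX, hY]
    induction X with
    | zero => simp
    | tmul a b => simp [h, counitLeft]
    | add X Y hX hY => simp only [map_add, hX, hY]
  have mul (X Y : A ⊗[k] A) :
      F (emb13 k A X * emb23 k A Y) = ((1 : A) ⊗ₜ[k] counitLeft k A X) * Y := by
    induction X with
    | zero => simp
    | add X X' hX hX' => simp only [map_add, add_mul, TensorProduct.tmul_add, hX, hX']
    | tmul a b =>
      induction Y with
      | zero => simp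
      | add Y Y' hY hY' => simp only [map_add, mul_add, hY, hY']
      | tmul a' b' => simp [F, emb13, emb23, counitLeft]
  have key : ((1 : A) ⊗ₜ[k] counitLeft k A R) * R = 1 * R := by
    rw [← mul, ← hR.comul_tensor_id, comul, one_mul]
  simpa [Algebra.TensorProduct.one_def] using congr(mul' k A $(hR.isUnit.mul_right_cancel key))

theorem IsUniversalRMatrix.counitRight_eq_one {R : A ⊗[k] A} (hR : IsUniversalRMatrix k A R) :
    counitRight k A R = 1 := by
  let F : A ⊗[k] (A ⊗[k] A) →ₗ[k] A ⊗[k] A := lTensor A (counitLeft k A)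
  have comul (X : A ⊗[k] A) : F (lTensor A (Coalgebra.comul (R := k)) X) = X := by
    induction X with
    | zero => simp
    | tmul a b => simp [F, counitLeft]
    | add X Y hX hY => simp only [map_add, hX, hY]
  have mul (X Y : A ⊗[k] A) :
      F (emb13 k A X * emb12 k A Y) = X * (counitRight k A Y ⊗ₜ[k] (1 : A)) := by
    induction X with
    | zero => simp
    | add X X' hX hX' => simp only [map_add, add_mul, hX, hX']
    | tmul a b =>
      induction Y with
      | zero => simp
      | add Y Y' hY hY' => simp only [map_add, mul_add, TensorProduct.add_tmul, hY, hY']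
      | tmul a' b' => simp [F, emb13, emb12, counitLeft, counitRight, TensorProduct.smul_tmul']
  have key : R * (counitRight k A R ⊗ₜ[k] (1 : A)) = R * 1 := by
    rw [← mul, ← hR.id_tensor_comul, comul, mul_one]
  simpa [Algebra.TensorProduct.one_def] using congr(mul' k A $(hR.isUnit.mul_left_cancel key))

/-- `(S ⊗ id)(R)` is a left inverse of `R`. -/
theorem IsUniversalRMatrix.rTensor_antipode_mul {R : A ⊗[k] A} (hR : IsUniversalRMatrix k A R) :
    rTensor A (HopfAlgebra.antipode k) R * R = 1 := by
  let F : A ⊗[k] (A ⊗[k] A) →ₗ[k] A ⊗[k] A :=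
    rTensor A (mul' k A ∘ₗ rTensor A (HopfAlgebra.antipode k)) ∘ₗ
      (TensorProduct.assoc k A A A).symm.toLinearMap
  have comul (X : A ⊗[k] A) :
      F (TensorProduct.assoc k A A A (rTensor A (Coalgebra.comul (R := k)) X)) =
        1 ⊗ₜ counitLeft k A X := by
    induction X with
    | zero => simp
    | tmul a b => simp [F, counitLeft, Algebra.algebraMap_eq_smul_one, TensorProduct.smul_tmul']
    | add X Y hX hY => simp only [map_add, TensorProduct.tmul_add, hX, hY]
  have mul (X Y : A ⊗[k] A) :
      F (emb13 k A X * emb23 k A Y) = rTensor A (HopfAlgebra.antipode k) X * Y := by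
    induction X with
    | zero => simp
    | add X X' hX hX' => simp only [map_add, add_mul, hX, hX']
    | tmul a b =>
      induction Y with
      | zero => simp
      | add Y Y' hY hY' => simp only [map_add, mul_add, hY, hY']
      | tmul a' b' => simp [F, emb13, emb23]
  rw [← mul, ← hR.comul_tensor_id, comul, hR.counitLeft_eq_one, Algebra.TensorProduct.one_def]

/-- `(S ⊗ id)(R)` is a right inverse of `R`. -/
theorem IsUniversalRMatrix.mul_rTensor_antipode {R : A ⊗[k] A} (hR : IsUniversalRMatrix k A R) :
    R * rTensor A (HopfAlgebra.antipode k) R = 1 :=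
  hR.isUnit.mul_right_cancel (by rw [mul_assoc, hR.rTensor_antipode_mul, mul_one, one_mul])

theorem IsUniversalRMatrix.rTensor_antipode_mul_map_antipode {R : A ⊗[k] A}
    (hR : IsUniversalRMatrix k A R) :
    rTensor A (HopfAlgebra.antipode k) R *
      TensorProduct.map (HopfAlgebra.antipode k) (HopfAlgebra.antipode k) R = 1 := by
  let F : A ⊗[k] (A ⊗[k] A) →ₗ[k] A ⊗[k] A :=
    TensorProduct.map (HopfAlgebra.antipode k) (mul' k A ∘ₗ lTensor A (HopfAlgebra.antipode k))
  have comul (X : A ⊗[k] A) : F (lTensor A (Coalgebra.comul (R := k)) X) =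
      HopfAlgebra.antipode k (counitRight k A X) ⊗ₜ 1 := by
    induction X with
    | zero => simp
    | tmul a b => simp [F, counitRight, Algebra.algebraMap_eq_smul_one, TensorProduct.smul_tmul']
    | add X Y hX hY => simp only [map_add, TensorProduct.add_tmul, hX, hY]
  have mul (X Y : A ⊗[k] A) : F (emb13 k A X * emb12 k A Y) =
      rTensor A (HopfAlgebra.antipode k) Y *
        TensorProduct.map (HopfAlgebra.antipode k) (HopfAlgebra.antipode k) X := by
    induction X with
    | zero => simp
    | add X X' hX hX' => simp only [map_add, add_mul, mul_add, hX, hX']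
    | tmul a b =>
      induction Y with
      | zero => simp
      | add Y Y' hY hY' => simp only [map_add, mul_add, add_mul, hY, hY']
      | tmul a' b' => simp [F, emb13, emb12, HopfAlgebra.antipode_mul_antidistrib]
  rw [← mul, ← hR.id_tensor_comul, comul, hR.counitRight_eq_one, HopfAlgebra.antipode_one,
    Algebra.TensorProduct.one_def]

/-- A universal R-matrix is invariant under `S ⊗ S`. -/
theorem IsUniversalRMatrix.map_antipode {R : A ⊗[k] A} (hR : IsUniversalRMatrix k A R) :
    TensorProduct.map (HopfAlgebra.antipode k) (HopfAlgebra.antipode k) R = R := by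
  simpa only [← mul_assoc, hR.mul_rTensor_antipode, one_mul, mul_one] using
    congr(R * $hR.rTensor_antipode_mul_map_antipode)

variable (k A)

/-- The Drinfeld element `u` of a universal R-matrix is a unit of `A`, with
inverse `u' = m((id ⊗ S²)(τ(R)))`: one has `u·u' = u'·u = 1`. -/
theorem drinfeldU_unit (R : A ⊗[k] A) (hR : IsUniversalRMatrix k A R) :
    drinfeldU k A R * drinfeldU' k A R = 1 ∧
    drinfeldU' k A R * drinfeldU k A R = 1 := by
  set T : A →ₗ[k] A := HopfAlgebra.antipode k ∘ₗ HopfAlgebra.antipode k with hT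
  set u := drinfeldU k A R with hu
  have conj (a : A) : u * a = T a * u :=
    mul_eq_antipode_antipode_mul k A (antipodeSandwich_drinfeldU_comul k A hR.comm_comul) a
  have left (X : A ⊗[k] A) :
      sandwich k A u X = sandwich k A 1 (rTensor A T X) * u := by
    induction X with
    | zero => simp
    | tmul a b => simp [mul_assoc, conj]
    | add X Y hX hY => simp only [map_add, add_mul, hX, hY]
  have right (X : A ⊗[k] A) :
      sandwich k A u (TensorProduct.map T T X) = u * sandwich k A 1 (rTensor A T X) := by
    induction X with
    | zero => simp
    | tmul a b =>
      rw [TensorProduct.map_tmul, sandwich_tmul, rTensor_tmul, sandwich_tmul, ← conj, mul_one,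
        mul_assoc]
    | add X Y hX hY => simp only [map_add, mul_add, hX, hY]
  have invariant : TensorProduct.map T T R = R := by
    rw [hT, TensorProduct.map_comp, LinearMap.comp_apply, hR.map_antipode, hR.map_antipode]
  have one : sandwich k A u R = 1 := by
    have h : lTensor A (HopfAlgebra.antipode k) (rTensor A (HopfAlgebra.antipode k) R) = R := by
      rw [← LinearMap.comp_apply, lTensor_comp_rTensor, hR.map_antipode]
    calc sandwich k A u R = antipodeSandwich k A u (rTensor A (HopfAlgebra.antipode k) R) := by
          rw [antipodeSandwich, LinearMap.comp_apply, h]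
      _ = antipodeSandwich k A 1 1 := by
          rw [hu, drinfeldU_eq_antipodeSandwich, ← antipodeSandwich_mul,
            hR.mul_rTensor_antipode]
      _ = 1 := by simp [Algebra.TensorProduct.one_def]
  rw [drinfeldU'_eq_sandwich]
  exact ⟨by rw [← right, invariant, one], by rw [← left, one]⟩

end
end

section
/- Let R be a universal R-matrix for A and let u = m((S ⊗ id)(τ(R))) be the Drinfeld element. Then the square of the antipode is inner via u: for every a ∈ A, u·a = S(S(a))·u (equivalently, S²(a) = u·a·u⁻¹ for all a ∈ A). -/
open TensorProduct LinearMap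

noncomputable section

variable (k : Type*) [Field k] (A : Type*) [Ring A] [HopfAlgebra k A]

section

open Coalgebra HopfAlgebra

variable {k A}

lemma drinfeldU_eq_lift (R : A ⊗[k] A) :
    drinfeldU k A R
      = (mul' k A ∘ₗ rTensor A (antipode k) ∘ₗ (TensorProduct.comm k A A).toLinearMap) R :=
  rfl

/-- The map `x ⊗ y ↦ S(y)·x`, whose value at `R` is the Drinfeld element, sends
`R·(x ⊗ y)` to `S(y)·u·x`. -/
lemma drinfeldU_mul_tmul (R : A ⊗[k] A) (x y : A) :
    drinfeldU k A (R * x ⊗ₜ[k] y) = antipode k y * drinfeldU k A R * x := by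
  induction R using TensorProduct.induction_on with
  | zero => simp [drinfeldU]
  | tmul p q => simp [drinfeldU, antipode_mul_antidistrib, mul_assoc]
  | add R T hR hT =>
    simp only [drinfeldU_eq_lift, add_mul, map_add, mul_add] at *
    rw [hR, hT]

lemma drinfeldU_comm_comul_mul (R : A ⊗[k] A) (b : A) :
    drinfeldU k A ((TensorProduct.comm k A A) (comul (R := k) b) * R)
      = counit (R := k) b • drinfeldU k A R := by
  induction R using TensorProduct.induction_on with
  | zero => simp [drinfeldU]
  | tmul p q =>
    have h := sum_antipode_mul_eq_smul (ℛ k b)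
    rw [← (ℛ k b).eq]
    calc _ = antipode k q * (∑ i ∈ (ℛ k b).index,
            antipode k ((ℛ k b).left i) * (ℛ k b).right i) * p := by
          simp [drinfeldU, antipode_mul_antidistrib, mul_assoc, Finset.sum_mul, Finset.mul_sum]
      _ = _ := by rw [h]; simp [drinfeldU]
  | add R T hR hT =>
    simp only [drinfeldU_eq_lift, mul_add, map_add, smul_add] at *
    rw [hR, hT]

/-- The Drinfeld element satisfies `Σ S(b₍₂₎)·u·b₍₁₎ = ε(b)·u`. -/
lemma IsUniversalRMatrix.sum_antipode_mul_drinfeldU_mul {R : A ⊗[k] A}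
    (hR : IsUniversalRMatrix k A R) {ι : Type*} {b : A} (r : Repr k b ι) :
    ∑ i ∈ r.index, antipode k (r.right i) * drinfeldU k A R * r.left i
      = counit (R := k) b • drinfeldU k A R := by
  rw [← drinfeldU_comm_comul_mul, ← hR.comm_comul, ← r.eq, Finset.mul_sum,
    drinfeldU_eq_lift (∑ i ∈ r.index, _), map_sum]
  exact Finset.sum_congr rfl fun i _ => (drinfeldU_mul_tmul R _ _).symm

end

/-- The square of the antipode is inner via the Drinfeld element `u`:
`u·a = S(S(a))·u` for every `a ∈ A`. -/
theorem antipode_sq_inner (R : A ⊗[k] A) (hR : IsUniversalRMatrix k A R) (a : A) :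
    drinfeldU k A R * a
      = HopfAlgebra.antipode (R := k) (HopfAlgebra.antipode (R := k) a) * drinfeldU k A R := by
  set u := drinfeldU k A R with hu
  let S : A →ₗ[k] A := HopfAlgebra.antipode k
  let r := Coalgebra.Repr.arbitrary k a
  let r₁ := fun i => Coalgebra.Repr.arbitrary k (r.left i)
  let r₂ := fun i => Coalgebra.Repr.arbitrary k (r.right i)
  have coassoc := congr((mul' k A ∘ₗ (TensorProduct.comm k A A).toLinearMap ∘ₗ
      lTensor A (mul' k A ∘ₗ (TensorProduct.comm k A A).toLinearMap))
    $(Coalgebra.sum_map_tmul_tmul_eq (mulLeft k u) S (S ∘ₗ S) a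
      (repr := r) (a₁ := r₁) (a₂ := r₂)))
  simp only [map_sum, LinearMap.comp_apply, LinearEquiv.coe_coe, lTensor_tmul,
    TensorProduct.comm_tmul, mul'_apply, mulLeft_apply] at coassoc
  have left : ∑ i ∈ r.index, ∑ j ∈ (r₂ i).index,
      S (S ((r₂ i).right j)) * S ((r₂ i).left j) * (u * r.left i) = u * a := by
    have h (i) : ∑ j ∈ (r₂ i).index, S (S ((r₂ i).right j)) * S ((r₂ i).left j)
        = Coalgebra.counit (R := k) (r.right i) • 1 := by
      have := congr(S $(HopfAlgebra.sum_mul_antipode_eq_smul (r₂ i)))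
      simpa [S, HopfAlgebra.antipode_mul_antidistrib] using this
    have h' := congr(TensorProduct.lift (lsmul k A).flip
      $(Coalgebra.sum_tmul_counit_eq r))
    simp only [map_sum, TensorProduct.lift.tmul] at h'
    simp only [← Finset.sum_mul, h, smul_mul_assoc, one_mul]
    simp only [← mul_smul_comm, ← Finset.mul_sum]
    congr 1
    simpa using h'
  have right : ∑ i ∈ r.index, ∑ j ∈ (r₁ i).index,
      S (S (r.right i)) * S ((r₁ i).right j) * (u * (r₁ i).left j) = S (S a) * u := by
    have h (i) := hR.sum_antipode_mul_drinfeldU_mul (r₁ i)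
    simp only [mul_assoc] at h ⊢
    simp only [← Finset.mul_sum, S, hu, h, mul_smul_comm]
    simp only [← smul_mul_assoc, ← Finset.sum_mul, ← map_smul, ← map_sum,
      Coalgebra.sum_counit_smul]
  exact left.symm.trans (coassoc.trans right)

end
end

section
/- Let (A, R, K) be a ribbon Hopf algebra, V a finite-dimensional k-vector space, and π : A → End_k(V) an algebra homomorphism (a finite-dimensional representation of A). Define C_V ∈ A as the image of (π(K⁻¹) ⊗ 1)·(π ⊗ id)(τ(R)·R) ∈ End_k(V) ⊗ A under the partial trace map (trace ⊗ id) : End_k(V) ⊗ A → A. Then C_V is central in A: C_V·a = a·C_V for all a ∈ A. -/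
open TensorProduct LinearMap

noncomputable section

variable (k : Type*) [Field k] (A : Type*) [Ring A] [HopfAlgebra k A]

/-- The central element `C_V`: the image of
`(π(K⁻¹) ⊗ 1)·(π ⊗ id)(τ(R)·R) ∈ End_k(V) ⊗ A` under the partial trace
`(trace ⊗ id) : End_k(V) ⊗ A → A` (identifying `k ⊗ A ≃ A`). -/
def centralC (V : Type*) [AddCommGroup V] [Module k V]
    (π : A →ₐ[k] Module.End k V) (Ki : A) (R : A ⊗[k] A) : A :=
  (TensorProduct.lid k A)
    (rTensor A (LinearMap.trace k V)
      ((π Ki ⊗ₜ[k] (1 : A)) *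
        rTensor A π.toLinearMap ((TensorProduct.comm k A A) R * R)))

open Coalgebra HopfAlgebra

variable {k A}

/-- Contraction of the first tensor factor with a linear functional:
`a ⊗ b ↦ f a • b`. -/
def sliceLeft (f : A →ₗ[k] k) : A ⊗[k] A →ₗ[k] A :=
  (TensorProduct.lid k A).toLinearMap ∘ₗ rTensor A f

@[simp]
lemma sliceLeft_tmul (f : A →ₗ[k] k) (x y : A) :
    sliceLeft f (x ⊗ₜ y) = f x • y := by
  simp [sliceLeft]

lemma sliceLeft_one_tmul_mul (f : A →ₗ[k] k) (d : A) (t : A ⊗[k] A) :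
    sliceLeft f ((1 ⊗ₜ d) * t) = d * sliceLeft f t := by
  induction t with
  | zero => simp
  | tmul x y => simp
  | add x y hx hy => simp only [mul_add, map_add, hx, hy]

lemma sliceLeft_mul_tmul (f : A →ₗ[k] k)
    (hf : ∀ x y, f (x * y) = f (antipode k (antipode k y) * x))
    (c d : A) (t : A ⊗[k] A) :
    sliceLeft f (t * (c ⊗ₜ d)) =
      sliceLeft f ((antipode k (antipode k c) ⊗ₜ 1) * t) * d := by
  induction t with
  | zero => simp
  | tmul x y => simp [hf x c]
  | add x y hx hy => simp only [mul_add, add_mul, map_add, hx, hy]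

/-- Contracting an element that commutes with the image of the comultiplication with a
functional that is a trace up to the square of the antipode gives a central element. -/
theorem sliceLeft_central (f : A →ₗ[k] k)
    (hf : ∀ x y, f (x * y) = f (antipode k (antipode k y) * x))
    (T : A ⊗[k] A) (hT : ∀ a : A, T * comul (R := k) a = comul (R := k) a * T) (a : A) :
    sliceLeft f T * a = a * sliceLeft f T := by
  let G₁ : A ⊗[k] (A ⊗[k] A) →ₗ[k] A := TensorProduct.lift
    (LinearMap.mk₂ k (fun b w => sliceLeft f ((antipode k b ⊗ₜ 1) * (T * w)))
      (by intros; simp only [map_add, add_tmul, add_mul])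
      (by intros; simp only [map_smul, ← smul_tmul', smul_mul_assoc])
      (by intros; simp only [map_add, mul_add])
      (by intros; simp only [map_smul, mul_smul_comm]))
  let G₂ : A ⊗[k] (A ⊗[k] A) →ₗ[k] A := TensorProduct.lift
    (LinearMap.mk₂ k (fun b w => sliceLeft f ((antipode k b ⊗ₜ 1) * (w * T)))
      (by intros; simp only [map_add, add_tmul, add_mul])
      (by intros; simp only [map_smul, ← smul_tmul', smul_mul_assoc])
      (by intros; simp only [map_add, mul_add, add_mul])
      (by intros; simp only [map_smul, mul_smul_comm, smul_mul_assoc]))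
  have hG₁ (b c d : A) : G₁ (b ⊗ₜ (c ⊗ₜ d)) =
      sliceLeft f ((antipode k (b * antipode k c) ⊗ₜ 1) * T) * d := by
    change sliceLeft f ((antipode k b ⊗ₜ 1) * (T * (c ⊗ₜ d))) = _
    rw [← mul_assoc, sliceLeft_mul_tmul f hf, ← mul_assoc,
      Algebra.TensorProduct.tmul_mul_tmul, one_mul, antipode_mul_antidistrib]
  have hG₂ (b c d : A) : G₂ (b ⊗ₜ (c ⊗ₜ d)) =
      d * sliceLeft f (((antipode k b * c) ⊗ₜ 1) * T) := by
    change sliceLeft f ((antipode k b ⊗ₜ 1) * ((c ⊗ₜ d) * T)) = _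
    rw [← sliceLeft_one_tmul_mul, ← mul_assoc, ← mul_assoc]
    simp
  let r := ℛ k a
  let r₁ := fun i => ℛ k (r.left i)
  have key : ∀ G : A ⊗[k] (A ⊗[k] A) →ₗ[k] A,
      G (lTensor A comul (comul (R := k) a)) = ∑ i ∈ r.index, ∑ j ∈ (r₁ i).index,
        G ((r₁ i).left j ⊗ₜ ((r₁ i).right j ⊗ₜ r.right i)) := by
    intro G
    simp only [← map_sum]
    rw [sum_tmul_tmul_eq r r₁ (fun i => ℛ k (r.right i)), ← congr(lTensor A comul $(r.eq))]
    simp only [← tmul_sum, (ℛ k (r.right _)).eq, map_sum, lTensor_tmul]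
  have hL : G₁ (lTensor A comul (comul (R := k) a)) = sliceLeft f T * a := by
    simp only [key, hG₁, ← Finset.sum_mul, ← map_sum, ← sum_tmul]
    simp only [r₁, sum_mul_antipode_eq_smul, map_smul, antipode_one, ← smul_tmul',
      ← Algebra.TensorProduct.one_def, smul_mul_assoc, one_mul]
    simp only [← mul_smul_comm, ← Finset.mul_sum, sum_counit_smul]
  have hR : G₂ (lTensor A comul (comul (R := k) a)) = a * sliceLeft f T := by
    simp only [key, hG₂, ← Finset.mul_sum, ← map_sum, ← sum_tmul, ← Finset.sum_mul]
    simp only [r₁, sum_antipode_mul_eq_smul, map_smul, ← smul_tmul',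
      ← Algebra.TensorProduct.one_def, smul_mul_assoc, one_mul]
    simp only [mul_smul_comm, ← smul_mul_assoc, ← Finset.sum_mul, sum_counit_smul]
  rw [← hL, ← hR, ← congr(lTensor A comul $(r.eq))]
  simp only [map_sum, lTensor_tmul]
  refine Finset.sum_congr rfl fun i _ => ?_
  change sliceLeft f ((antipode k _ ⊗ₜ 1) * (T * comul _)) =
    sliceLeft f ((antipode k _ ⊗ₜ 1) * (comul _ * T))
  rw [hT]

lemma IsUniversalRMatrix.comm_mul_self_commute {R : A ⊗[k] A} (hR : IsUniversalRMatrix k A R)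
    (a : A) :
    (TensorProduct.comm k A A R * R) * comul (R := k) a =
      comul (R := k) a * (TensorProduct.comm k A A R * R) := by
  have hmul (x y : A ⊗[k] A) : TensorProduct.comm k A A (x * y) =
      TensorProduct.comm k A A x * TensorProduct.comm k A A y :=
    map_mul (Algebra.TensorProduct.comm k A A) x y
  have h := congr(TensorProduct.comm k A A $(hR.comm_comul a))
  rw [hmul, hmul, TensorProduct.comm_comm] at h
  rw [mul_assoc, hR.comm_comul, ← mul_assoc, h, mul_assoc]

lemma centralC_eq_sliceLeft (V : Type*) [AddCommGroup V] [Module k V]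
    (π : A →ₐ[k] Module.End k V) (Ki : A) (R : A ⊗[k] A) :
    centralC k A V π Ki R =
      sliceLeft (LinearMap.trace k V ∘ₗ π.toLinearMap ∘ₗ LinearMap.mulLeft k Ki)
        (TensorProduct.comm k A A R * R) := by
  unfold centralC
  induction TensorProduct.comm k A A R * R with
  | zero => simp
  | tmul x y => simp
  | add x y hx hy => simp only [map_add, mul_add, hx, hy]

variable (k A)

/-- For a ribbon Hopf algebra `(A, R, K)` and a finite-dimensional
representation `π : A → End_k(V)`, the element `C_V` is central in `A`. -/
theorem centralC_central (R : A ⊗[k] A) (hR : IsUniversalRMatrix k A R)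
    (K Ki : A) (hK : K * Ki = 1) (hK' : Ki * K = 1)
    (hgrouplike : Coalgebra.comul (R := k) K = K ⊗ₜ[k] K)
    (hS2 : ∀ a : A,
      HopfAlgebra.antipode (R := k) (HopfAlgebra.antipode (R := k) a) = K * a * Ki)
    (V : Type*) [AddCommGroup V] [Module k V] [FiniteDimensional k V]
    (π : A →ₐ[k] Module.End k V) (a : A) :
    centralC k A V π Ki R * a = a * centralC k A V π Ki R := by
  rw [centralC_eq_sliceLeft]
  refine sliceLeft_central _ (fun x y => ?_) _ hR.comm_mul_self_commute a
  have h : Ki * (K * y * Ki * x) = y * (Ki * x) := by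
    simp only [← mul_assoc, hK', one_mul]
  simp only [LinearMap.comp_apply, LinearMap.mulLeft_apply, AlgHom.toLinearMap_apply, hS2, h]
  rw [← mul_assoc, map_mul, LinearMap.trace_mul_comm, ← map_mul]

end
end

section
/- For every left A-module W that is finite-dimensional as a k-vector space, every A-module endomorphism f : W → W, and every element a ∈ A, the trace of the k-linear endomorphism of W given by w ↦ a • (z • (f w)) is zero. -/
universe u v w

/-- If a ring element `z` annihilates every simple subquotient of an Artinian and Noetherian module
`W`, then some power of `z` annihilates `W`. -/
theorem exists_pow_smul_eq_zero_of_covBy {A : Type*} [Ring A] {W : Type*} [AddCommGroup W]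
    [Module A W] [IsArtinian A W] [IsNoetherian A W] {z : A}
    (h : ∀ M N : Submodule A W, M ⋖ N → ∀ x ∈ N, z • x ∈ M) :
    ∃ n : ℕ, ∀ x : W, z ^ n • x = 0 := by
  suffices H : ∀ N : Submodule A W, ∃ n : ℕ, ∀ x ∈ N, z ^ n • x = 0 by
    obtain ⟨n, hn⟩ := H ⊤
    exact ⟨n, fun x => hn x Submodule.mem_top⟩
  intro N
  induction N using WellFoundedLT.induction with
  | ind N ih =>
    rcases eq_or_ne N ⊥ with rfl | hN
    · exact ⟨0, fun x hx => by simpa using hx⟩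
    · obtain ⟨M, -, hM⟩ := exists_le_covBy_of_lt (bot_lt_iff_ne_bot.2 hN)
      obtain ⟨n, hn⟩ := ih M hM.lt
      refine ⟨n + 1, fun x hx => ?_⟩
      rw [pow_succ, mul_smul]
      exact hn _ (h M N hM x hx)

/-- A central element acting nilpotently stays nilpotent after composing with a module endomorphism
and with the action of any ring element. -/
theorem isNilpotent_smul_smul_restrictScalars {k A W : Type*} [CommRing k] [Ring A] [Algebra k A]
    [AddCommGroup W] [Module k W] [Module A W] [IsScalarTower k A W] [SMulCommClass k A W]
    {z : A} (hz : ∀ a : A, z * a = a * z) {n : ℕ} (hn : ∀ x : W, z ^ n • x = 0)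
    (f : W →ₗ[A] W) (a : A) :
    IsNilpotent (a • z • (f.restrictScalars k) : W →ₗ[k] W) := by
  have key : ∀ (m : ℕ) (x : W),
      ((a • z • (f.restrictScalars k) : W →ₗ[k] W) ^ m) x = a ^ m • z ^ m • (f ^ m) x := by
    intro m
    induction m with
    | zero => intro x; simp
    | succ m ih =>
      intro x
      have hc : z ^ m * a = a * z ^ m := Commute.pow_left (hz a) m
      rw [pow_succ, Module.End.mul_apply, ih, pow_succ a, pow_succ z, pow_succ f]
      simp only [LinearMap.smul_apply, LinearMap.coe_restrictScalars, map_smul,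
        Module.End.mul_apply, smul_smul]
      congr 1
      simp only [mul_assoc]
      rw [← mul_assoc (z ^ m) a z, hc, mul_assoc]
  refine ⟨n, LinearMap.ext fun x => ?_⟩
  rw [key, hn, smul_zero, LinearMap.zero_apply]

/-- If `z` annihilates all simple finite-dimensional modules, then it maps a finite-dimensional
module into each submodule with simple quotient. -/
theorem smul_mem_of_isSimpleModule_quotient {k A : Type*} [Field k] [Ring A] [Algebra k A] {z : A}
    (hzero : ∀ (M : Type u) [AddCommGroup M] [Module k M] [Module A M]
      [IsScalarTower k A M] [FiniteDimensional k M], IsSimpleModule A M → ∀ m : M, z • m = 0)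
    {V : Type u} [AddCommGroup V] [Module k V] [Module A V] [IsScalarTower k A V]
    [FiniteDimensional k V] (P : Submodule A V) (hP : IsSimpleModule A (V ⧸ P)) (x : V) :
    z • x ∈ P := by
  have : FiniteDimensional k (V ⧸ P) :=
    Module.Finite.of_surjective (P.mkQ.restrictScalars k) P.mkQ_surjective
  rw [← Submodule.Quotient.mk_eq_zero, Submodule.Quotient.mk_smul]
  exact hzero (V ⧸ P) hP _

/-- If `z` annihilates all simple finite-dimensional modules, then it maps each submodule of a
finite-dimensional module into every submodule that it covers. -/
theorem smul_mem_of_covBy {k A : Type*} [Field k] [Ring A] [Algebra k A] {z : A}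
    (hzero : ∀ (M : Type u) [AddCommGroup M] [Module k M] [Module A M]
      [IsScalarTower k A M] [FiniteDimensional k M], IsSimpleModule A M → ∀ m : M, z • m = 0)
    {W : Type u} [AddCommGroup W] [Module k W] [Module A W] [IsScalarTower k A W]
    [FiniteDimensional k W] {M N : Submodule A W} (hMN : M ⋖ N) {x : W} (hx : x ∈ N) :
    z • x ∈ M := by
  have : FiniteDimensional k N :=
    Module.Finite.of_injective (N.subtype.restrictScalars k) N.injective_subtype
  exact smul_mem_of_isSimpleModule_quotient hzero _
    ((covBy_iff_quot_is_simple hMN.le).1 hMN) (⟨x, hx⟩ : N)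

/-- Let `k` be a field, `A` an associative unital `k`-algebra, and `z` a central
element of `A` acting as zero on every left `A`-module that is simple and
finite-dimensional over `k`.  Then for every left `A`-module `W` that is
finite-dimensional over `k`, every `A`-module endomorphism `f : W → W` and
every `a ∈ A`, the trace of the `k`-linear endomorphism `w ↦ a • z • f w` of
`W` vanishes. -/
theorem trace_central_smul_eq_zero
    {k : Type u} {A : Type v} [Field k] [Ring A] [Algebra k A]
    (z : A) (hz : ∀ a : A, z * a = a * z)
    (hzero : ∀ (M : Type (max u v w)) [AddCommGroup M] [Module k M] [Module A M]
      [IsScalarTower k A M] [FiniteDimensional k M],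
      IsSimpleModule A M → ∀ m : M, z • m = 0)
    (W : Type (max u v w)) [AddCommGroup W] [Module k W] [Module A W]
    [IsScalarTower k A W] [SMulCommClass k A W] [FiniteDimensional k W]
    (f : W →ₗ[A] W) (a : A) :
    LinearMap.trace k W (a • z • (f.restrictScalars k)) = 0 := by
  have : IsArtinian A W := isArtinian_of_tower k inferInstance
  have : IsNoetherian A W := isNoetherian_of_tower k inferInstance
  obtain ⟨n, hn⟩ : ∃ n : ℕ, ∀ x : W, z ^ n • x = 0 :=
    exists_pow_smul_eq_zero_of_covBy fun _ _ hMN _ hx => smul_mem_of_covBy hzero hMN hx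
  exact (LinearMap.isNilpotent_trace_of_isNilpotent
    (isNilpotent_smul_smul_restrictScalars hz hn f a)).eq_zero
end

section
/- For every λ = (λ₁, λ₂) ∈ Λ, the constants d_μ solve the defining system of equations: q^{−λ₁(λ₁+1)−λ₂(λ₂−1)} = Σ_{μ∈Λ} d_μ · q^{μ₁(μ₁−2λ₁)+μ₂(μ₂−2λ₂)} · Σ_{ν=0}^{n_μ} q^{2ν(n_λ+1)}. -/
open Finset

noncomputable section

/-- `q = exp(2πi/N)`. -/
def qRoot (N : ℕ) : ℂ := Complex.exp (2 * Real.pi * Complex.I / N)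

/-- The Gauss sum `G_k = Σ_{ν=0}^{N-1} q^{kν²}`. -/
def gauss (N : ℕ) (k : ℤ) : ℂ := ∑ ν ∈ range N, qRoot N ^ (k * (ν : ℤ) ^ 2)

/-- `n_λ = (λ₁ - λ₂) mod N ∈ {0,…,N-1}`. -/
def nwt (N : ℕ) (lam : ℕ × ℕ) : ℕ := ((((lam.1 : ℤ) - (lam.2 : ℤ)) % (N : ℤ))).toNat

/-- `Λ = {λ ∈ {0,…,N-1}² : n_λ ≠ N-1}`, indexing the irreducible
highest-weight `U_q(gl(2))`-modules of nonzero `q`-dimension. -/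
def LamSet (N : ℕ) : Finset (ℕ × ℕ) :=
  (range N ×ˢ range N).filter fun lam => nwt N lam ≠ N - 1

/-- The constants
`d_λ = q^{(N²+1)/2}·(G_{N-1}/N)²·q^{-λ₁(λ₁+1)-λ₂(λ₂-1)}·(q^{λ₁²+λ₂²} + x_{n_λ+1} + x_{N-n_λ-1})`,
depending on arbitrary complex parameters `x₁, …, x_{N-1}`. -/
def dconst (N : ℕ) (x : ℕ → ℂ) (lam : ℕ × ℕ) : ℂ :=
  qRoot N ^ (((N ^ 2 + 1) / 2 : ℕ)) * (gauss N ((N : ℤ) - 1) / (N : ℂ)) ^ 2 *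
    qRoot N ^ (-(lam.1 : ℤ) * ((lam.1 : ℤ) + 1) - (lam.2 : ℤ) * ((lam.2 : ℤ) - 1)) *
    (qRoot N ^ ((lam.1 : ℤ) ^ 2 + (lam.2 : ℤ) ^ 2) + x (nwt N lam + 1) + x (N - nwt N lam - 1))

theorem qRoot_zpow (N : ℕ) [NeZero N] (z : ℤ) :
    qRoot N ^ z = ZMod.stdAddChar (z : ZMod N) := by
  rw [ZMod.stdAddChar_coe, qRoot, ← Complex.exp_int_mul]
  congr 1
  ring

theorem qRoot_pow (N : ℕ) [NeZero N] (n : ℕ) :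
    qRoot N ^ n = ZMod.stdAddChar (n : ZMod N) := by
  simpa using qRoot_zpow N n

theorem nwt_eq_val (N : ℕ) [NeZero N] (mu : ℕ × ℕ) :
    nwt N mu = ((mu.1 : ZMod N) - (mu.2 : ZMod N)).val := by
  have h := ZMod.val_intCast (n := N) ((mu.1 : ℤ) - (mu.2 : ℤ))
  push_cast at h
  rw [nwt, ← h, Int.toNat_natCast]

theorem natCast_nwt (N : ℕ) [NeZero N] (mu : ℕ × ℕ) :
    (nwt N mu : ZMod N) = (mu.1 : ZMod N) - (mu.2 : ZMod N) := by
  rw [nwt_eq_val, ZMod.natCast_zmod_val]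

theorem sum_range_eq_sum_zmod {M : Type*} [AddCommMonoid M] (N : ℕ) [NeZero N]
    (f : ZMod N → M) : ∑ a ∈ range N, f a = ∑ a : ZMod N, f a := by
  refine Finset.sum_bij' (fun a _ => (a : ZMod N)) (fun a _ => a.val) ?_ ?_ ?_ ?_ ?_
  · simp
  · intro a _
    simpa using ZMod.val_lt a
  · intro a ha
    exact ZMod.val_cast_of_lt (mem_range.mp ha)
  · simp
  · simp

theorem gauss_eq_sum_zmod (N : ℕ) [NeZero N] (k : ℤ) :
    gauss N k = ∑ a : ZMod N, ZMod.stdAddChar ((k : ZMod N) * a ^ 2) := by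
  rw [gauss, ← sum_range_eq_sum_zmod N]
  refine sum_congr rfl fun a _ => ?_
  rw [qRoot_zpow]
  push_cast
  rfl

section AddChar

variable {N : ℕ} [NeZero N] (e : AddChar (ZMod N) ℂ)

/-- Completing the square in a quadratic Gauss sum modulo an odd number. -/
theorem sum_sq_sub_mul {h : ZMod N} (hh : 2 * h = 1) (t : ZMod N) :
    ∑ a, e (a ^ 2 - t * a) = e (-(h * t) ^ 2) * ∑ a, e (a ^ 2) := by
  rw [← Equiv.sum_comp (Equiv.addRight (h * t)), mul_sum]
  refine sum_congr rfl fun a _ => ?_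
  rw [← AddChar.map_add_eq_mul, Equiv.coe_addRight]
  congr 1
  linear_combination (a * t + h * t ^ 2) * hh

theorem sum_sq_mul_sum_neg_sq (he : e.IsPrimitive) {h : ZMod N} (hh : 2 * h = 1) :
    (∑ a, e (a ^ 2)) * ∑ b, e (-b ^ 2) = N := by
  calc (∑ a, e (a ^ 2)) * ∑ b, e (-b ^ 2)
      = ∑ b, ∑ a, e (a ^ 2) * e (-b ^ 2) := by rw [sum_mul_sum, sum_comm]
    _ = ∑ b, ∑ c, e (c ^ 2) * e (b * (2 * c)) := by
        refine sum_congr rfl fun b _ => ?_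
        rw [← Equiv.sum_comp (Equiv.addRight b)]
        refine sum_congr rfl fun c _ => ?_
        rw [← AddChar.map_add_eq_mul, ← AddChar.map_add_eq_mul, Equiv.coe_addRight]
        congr 1
        ring
    _ = ∑ c, e (c ^ 2) * ∑ b, e (b * (2 * c)) := by
        rw [sum_comm]
        simp only [mul_sum]
    _ = N := by
        have h2 (c : ZMod N) : 2 * c = 0 ↔ c = 0 :=
          ⟨fun hc => by linear_combination h * hc - c * hh, fun hc => by simp [hc]⟩
        simp [AddChar.sum_mulShift _ he, h2, ZMod.card]

/-- The reflection `(a, b) ↦ (b - 1, a + 1)` makes the contribution of an even function vanish. -/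
theorem sum_even_mul_odd_eq_zero (Y : ZMod N → ℂ) (hY : ∀ k, Y (-k) = Y k) (s m : ZMod N) :
    ∑ p : ZMod N × ZMod N, Y (p.1 - p.2 + 1) * e (-s * (p.1 + p.2)) *
      (e (-(m * (p.1 - p.2 + 1))) - e (m * (p.1 - p.2 + 1))) = 0 := by
  let σ : ZMod N × ZMod N ≃ ZMod N × ZMod N :=
    { toFun := fun p => (p.2 - 1, p.1 + 1)
      invFun := fun p => (p.2 - 1, p.1 + 1)
      left_inv := fun p => by simp
      right_inv := fun p => by simp }
  refine self_eq_neg.mp ?_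
  conv_lhs => rw [← Equiv.sum_comp σ]
  rw [← sum_neg_distrib]
  refine sum_congr rfl fun p _ => ?_
  have h1 : (σ p).1 - (σ p).2 + 1 = -(p.1 - p.2 + 1) := by
    change p.2 - 1 - (p.1 + 1) + 1 = _
    ring
  have h2 : (σ p).1 + (σ p).2 = p.1 + p.2 := by
    change p.2 - 1 + (p.1 + 1) = _
    ring
  rw [h1, h2, hY, mul_neg, neg_neg]
  ring

/-- The defining system over `ZMod N`, with denominators of the geometric sums cleared. -/
theorem sum_sq_add_even {h : ZMod N} (hh : 2 * h = 1)
    (Y : ZMod N → ℂ) (hY : ∀ k, Y (-k) = Y k) (u v m : ZMod N) (hm : m = u - v + 1) :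
    ∑ p : ZMod N × ZMod N, e (-p.1 * (p.1 + 1) - p.2 * (p.2 - 1)) *
        (e (p.1 ^ 2 + p.2 ^ 2) + Y (p.1 - p.2 + 1)) *
        e (p.1 * (p.1 - 2 * u) + p.2 * (p.2 - 2 * v)) * (1 - e (2 * m * (p.1 - p.2 + 1)))
      = e (-u * (u + 1) - v * (v - 1) - h) * (1 - e (2 * m)) * (∑ a, e (a ^ 2)) ^ 2 := by
  have expand (p : ZMod N × ZMod N) : e (-p.1 * (p.1 + 1) - p.2 * (p.2 - 1)) *
        (e (p.1 ^ 2 + p.2 ^ 2) + Y (p.1 - p.2 + 1)) *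
        e (p.1 * (p.1 - 2 * u) + p.2 * (p.2 - 2 * v)) * (1 - e (2 * m * (p.1 - p.2 + 1)))
      = e (p.1 ^ 2 - (2 * u + 1) * p.1) * e (p.2 ^ 2 - (2 * v - 1) * p.2)
        - e (2 * m) * (e (p.1 ^ 2 - (2 * v - 1) * p.1) * e (p.2 ^ 2 - (2 * u + 1) * p.2))
        + e m * (Y (p.1 - p.2 + 1) * e (-(u + v) * (p.1 + p.2)) *
          (e (-(m * (p.1 - p.2 + 1))) - e (m * (p.1 - p.2 + 1)))) := by
    obtain ⟨a, b⟩ := p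
    simp only [mul_add, mul_sub, add_mul, mul_one, mul_left_comm _ (Y _), mul_assoc (Y _),
      ← AddChar.map_add_eq_mul, mul_comm _ (Y _)]
    subst hm
    ring_nf
  simp only [expand, sum_add_distrib, sum_sub_distrib, ← mul_sum,
    sum_even_mul_odd_eq_zero e Y hY, mul_zero, add_zero]
  simp only [Fintype.sum_prod_type, ← sum_mul_sum, sum_sq_sub_mul e hh]
  have key : e (-(h * (2 * u + 1)) ^ 2) * e (-(h * (2 * v - 1)) ^ 2)
      = e (-u * (u + 1) - v * (v - 1) - h) := by
    rw [← AddChar.map_add_eq_mul]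
    congr 1
    linear_combination (-(u ^ 2 + v ^ 2 + u - v) * (2 * h + 1) - h) * hh
  rw [← key]
  ring

end AddChar

/-- For every `λ ∈ Λ` the constants `d_μ` solve the defining system
`q^{-λ₁(λ₁+1)-λ₂(λ₂-1)} = Σ_{μ∈Λ} d_μ q^{μ₁(μ₁-2λ₁)+μ₂(μ₂-2λ₂)} Σ_{ν=0}^{n_μ} q^{2ν(n_λ+1)}`
(with `N = 2r+1` odd and `q = exp(2πi/N)`). -/
theorem dconst_solves_system (r : ℕ) (hr : 1 ≤ r) (x : ℕ → ℂ)
    (lam : ℕ × ℕ) (hlam : lam ∈ LamSet (2 * r + 1)) :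
    qRoot (2 * r + 1) ^ (-(lam.1 : ℤ) * ((lam.1 : ℤ) + 1) - (lam.2 : ℤ) * ((lam.2 : ℤ) - 1))
      = ∑ mu ∈ LamSet (2 * r + 1),
          dconst (2 * r + 1) x mu *
            qRoot (2 * r + 1) ^
              ((mu.1 : ℤ) * ((mu.1 : ℤ) - 2 * (lam.1 : ℤ)) +
                (mu.2 : ℤ) * ((mu.2 : ℤ) - 2 * (lam.2 : ℤ))) *
            ∑ ν ∈ Finset.range (nwt (2 * r + 1) mu + 1),
              qRoot (2 * r + 1) ^ (2 * (ν : ℤ) * ((nwt (2 * r + 1) lam : ℤ) + 1)) := by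
  obtain ⟨N, hN⟩ : ∃ N, N = 2 * r + 1 := ⟨_, rfl⟩
  rw [← hN] at hlam ⊢
  have : NeZero N := ⟨by omega⟩
  have hN0 : (N : ℂ) ≠ 0 := NeZero.ne _
  let e : AddChar (ZMod N) ℂ := ZMod.stdAddChar
  have he : e.IsPrimitive := ZMod.isPrimitive_stdAddChar N
  obtain ⟨h, hhdef⟩ : ∃ h : ZMod N, h = (((N ^ 2 + 1) / 2 : ℕ) : ZMod N) := ⟨_, rfl⟩
  have hh : 2 * h = 1 := by
    have hd : 2 * ((N ^ 2 + 1) / 2) = N ^ 2 + 1 :=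
      Nat.mul_div_cancel' ⟨2 * r ^ 2 + 2 * r + 1, by rw [hN]; ring⟩
    rw [hhdef]
    simpa using congrArg (Nat.cast (R := ZMod N)) hd
  obtain ⟨m, hm⟩ : ∃ m : ZMod N, m = (lam.1 : ZMod N) - lam.2 + 1 := ⟨_, rfl⟩
  have hm0 : m ≠ 0 := by
    intro h0
    have hn : ((nwt N lam + 1 : ℕ) : ZMod N) = 0 := by
      push_cast
      rw [natCast_nwt, ← hm, h0]
    have hle := Nat.le_of_dvd (Nat.succ_pos _) ((ZMod.natCast_eq_zero_iff _ _).mp hn)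
    have hlt : nwt N lam < N := by
      rw [nwt_eq_val]
      exact ZMod.val_lt _
    exact (mem_filter.mp hlam).2 (by omega)
  have hD : 1 - e (2 * m) ≠ 0 := by
    intro h0
    have h2m : 2 * m = 0 :=
      ZMod.injective_stdAddChar (by
        rw [AddChar.map_zero_eq_one]
        exact (sub_eq_zero.mp h0).symm)
    exact hm0 (by linear_combination h * h2m - m * hh)
  have geom (mu : ℕ × ℕ) : (1 - e (2 * m)) * ∑ ν ∈ range (nwt N mu + 1),
      qRoot N ^ (2 * (ν : ℤ) * ((nwt N lam : ℤ) + 1))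
      = 1 - e (2 * m * ((mu.1 : ZMod N) - mu.2 + 1)) := by
    have hpow (j : ℕ) : e (2 * m) ^ j = e (2 * m * j) := by
      rw [← AddChar.map_nsmul_eq_pow, nsmul_eq_mul, mul_comm]
    have hterm (ν : ℕ) : qRoot N ^ (2 * (ν : ℤ) * ((nwt N lam : ℤ) + 1)) = e (2 * m) ^ ν := by
      rw [qRoot_zpow, hpow]
      push_cast
      rw [natCast_nwt, ← hm, mul_right_comm]
    simp only [hterm]
    rw [mul_neg_geom_sum, hpow]
    push_cast
    rw [natCast_nwt]
  let Y : ZMod N → ℂ := fun k => x k.val + x (N - k.val)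
  have hY (k : ZMod N) : Y (-k) = Y k := by
    rcases eq_or_ne k 0 with rfl | hk
    · simp
    · have : NeZero k := ⟨hk⟩
      have hlt := ZMod.val_lt k
      simp only [Y, ZMod.val_neg_of_ne_zero]
      rw [Nat.sub_sub_self hlt.le, add_comm]
  have hYx (mu : ℕ × ℕ) : x (nwt N mu + 1) + x (N - nwt N mu - 1)
      = Y ((mu.1 : ZMod N) - mu.2 + 1) := by
    have hlt : nwt N mu < N := by
      rw [nwt_eq_val]
      exact ZMod.val_lt _
    have hk : (mu.1 : ZMod N) - mu.2 + 1 = ((nwt N mu + 1 : ℕ) : ZMod N) := by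
      push_cast
      rw [natCast_nwt]
    rcases Nat.lt_or_ge (nwt N mu + 1) N with hlt' | hge
    · simp only [Y, hk, ZMod.val_cast_of_lt hlt', Nat.sub_sub]
    · have hE : nwt N mu + 1 = N := by omega
      simp only [Y, hk, Nat.sub_sub, hE, ZMod.natCast_self, ZMod.val_zero]
      simp [add_comm]
  have hG : gauss N ((N : ℤ) - 1) = ∑ a : ZMod N, e (-a ^ 2) := by
    rw [gauss_eq_sum_zmod]
    simp [e]
  have hGG := sum_sq_mul_sum_neg_sq e he hh
  rw [← hG] at hGG
  apply mul_left_cancel₀ hD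
  have hext : ∀ mu ∈ range N ×ˢ range N, mu ∉ LamSet N → ∑ ν ∈ range (nwt N mu + 1),
      qRoot N ^ (2 * (ν : ℤ) * ((nwt N lam : ℤ) + 1)) = 0 := by
    intro mu hmu hmu'
    have hnw : nwt N mu + 1 = N := by
      have : nwt N mu = N - 1 := by
        by_contra hne
        exact hmu' (mem_filter.mpr ⟨hmu, hne⟩)
      omega
    have hk : (mu.1 : ZMod N) - mu.2 + 1 = 0 := by
      rw [← natCast_nwt, ← Nat.cast_add_one, hnw, ZMod.natCast_self]
    refine (mul_eq_zero.mp ?_).resolve_left hD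
    rw [geom, hk, mul_zero, AddChar.map_zero_eq_one, sub_self]
  rw [sum_subset (show LamSet N ⊆ range N ×ˢ range N from filter_subset _ _)
    fun mu hmu hmu' => by rw [hext mu hmu hmu', mul_zero], mul_sum]
  let F : ZMod N → ZMod N → ℂ := fun a b => e (-a * (a + 1) - b * (b - 1)) *
    (e (a ^ 2 + b ^ 2) + Y (a - b + 1)) *
    e (a * (a - 2 * lam.1) + b * (b - 2 * lam.2)) * (1 - e (2 * m * (a - b + 1)))
  have hterm (mu : ℕ × ℕ) : (1 - e (2 * m)) * (dconst N x mu *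
      qRoot N ^ ((mu.1 : ℤ) * ((mu.1 : ℤ) - 2 * (lam.1 : ℤ)) +
        (mu.2 : ℤ) * ((mu.2 : ℤ) - 2 * (lam.2 : ℤ))) *
      ∑ ν ∈ range (nwt N mu + 1), qRoot N ^ (2 * (ν : ℤ) * ((nwt N lam : ℤ) + 1)))
      = e h * (gauss N ((N : ℤ) - 1) / N) ^ 2 * F mu.1 mu.2 := by
    rw [mul_left_comm, geom, dconst, add_assoc (qRoot N ^ _), hYx]
    simp only [qRoot_zpow, qRoot_pow, ← hhdef, F, e]
    push_cast
    ring
  have hsum := sum_sq_add_even e hh Y hY lam.1 lam.2 m hm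
  rw [Fintype.sum_prod_type] at hsum
  simp only [hterm, ← mul_sum, sum_product, sum_range_eq_sum_zmod N (F _)]
  rw [sum_range_eq_sum_zmod N fun a => ∑ b, F a b, hsum, qRoot_zpow]
  push_cast
  change _ * e _ = _
  have hsplit : e (-(lam.1 : ZMod N) * (lam.1 + 1) - lam.2 * (lam.2 - 1))
      = e h * e (-(lam.1 : ZMod N) * (lam.1 + 1) - lam.2 * (lam.2 - 1) - h) := by
    rw [← AddChar.map_add_eq_mul, add_sub_cancel]
  have hone : (gauss N ((N : ℤ) - 1) / N) ^ 2 * (∑ a, e (a ^ 2)) ^ 2 = 1 := by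
    rw [← mul_pow, div_mul_eq_mul_div, mul_comm, hGG, div_self hN0, one_pow]
  rw [hsplit]
  linear_combination -(1 - e (2 * m)) * e h *
    e (-(lam.1 : ZMod N) * (lam.1 + 1) - lam.2 * (lam.2 - 1) - h) * hone

end
end

section
/- With Λ = {(λ₁, λ₂, λ₃) ∈ {0,…,N−1}³ : λ₂ = 0 or λ₁ + λ₂ + 1 ≡ 0 (mod N)} the set of atypical weights, and d_λ = q^{−λ₃²}·a(λ₁, λ₃) if λ₂ = 0 and d_λ = q^{−λ₃²}·a(λ₂, (N−λ₃) mod N) if λ₂ ≠ 0, the normalization constant z = Σ_{λ∈Λ} d_λ · q^{−λ₃²} satisfies z = G_{N−1}² / N. -/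
open Finset

noncomputable section

/-- The set `Λ` of atypical weights:
`Λ = {(λ₁,λ₂,λ₃) ∈ {0,…,N-1}³ : λ₂ = 0 or λ₁+λ₂+1 ≡ 0 (mod N)}`. -/
def atypical (N : ℕ) : Finset (ℕ × ℕ × ℕ) :=
  (range N ×ˢ range N ×ˢ range N).filter
    fun lam => lam.2.1 = 0 ∨ (lam.1 + lam.2.1 + 1) % N = 0

/-- The constants `d_λ`: `d_λ = q^{-λ₃²}·a(λ₁,λ₃)` if `λ₂ = 0`, and
`d_λ = q^{-λ₃²}·a(λ₂,(N-λ₃) mod N)` if `λ₂ ≠ 0`. -/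
def dGl21 (N : ℕ) (a : ℕ → ℕ → ℂ) (lam : ℕ × ℕ × ℕ) : ℂ :=
  if lam.2.1 = 0 then qRoot N ^ (-((lam.2.2 : ℤ)) ^ 2) * a lam.1 lam.2.2
  else qRoot N ^ (-((lam.2.2 : ℤ)) ^ 2) * a lam.2.1 ((N - lam.2.2) % N)

theorem qRoot_pow_self {N : ℕ} (hN : N ≠ 0) : qRoot N ^ N = 1 :=
  (Complex.isPrimitiveRoot_exp N hN).pow_eq_one

theorem qRoot_ne_zero (N : ℕ) : qRoot N ≠ 0 := Complex.exp_ne_zero _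

theorem qRoot_zpow_sub_one_mul {N : ℕ} (hN : N ≠ 0) (m : ℤ) :
    qRoot N ^ (((N : ℤ) - 1) * m) = qRoot N ^ (-m) := by
  rw [show ((N : ℤ) - 1) * m = N * m + -m by ring, zpow_add₀ (qRoot_ne_zero N), zpow_mul,
    zpow_natCast, qRoot_pow_self hN, one_zpow, one_mul]

/-- A sum over the atypical weights, parametrized by `λ₁` where `λ₂ = 0` and by `λ₂` elsewhere. -/
theorem sum_atypical {N : ℕ} (hN : 0 < N) (f : ℕ × ℕ × ℕ → ℂ) :
    ∑ lam ∈ atypical N, f lam = ∑ ω ∈ range N,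
      (∑ θ ∈ range N, f (θ, 0, ω) + ∑ θ ∈ Ico 1 N, f (N - 1 - θ, θ, ω)) := by
  have row (y : ℕ) (hy : y ∈ Ico 1 N) (ω : ℕ) :
      (∑ x ∈ range N, if y = 0 ∨ (x + y + 1) % N = 0 then f (x, y, ω) else 0)
        = f (N - 1 - y, y, ω) := by
    rw [mem_Ico] at hy
    rw [sum_eq_single_of_mem (N - 1 - y) (mem_range.2 (by lia))]
    · rw [if_pos (Or.inr (by rw [show N - 1 - y + y + 1 = N by lia, Nat.mod_self]))]
    · intro x hx hne
      rw [mem_range] at hx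
      refine if_neg ?_
      rintro (h | h)
      · lia
      · obtain ⟨k, hk⟩ := Nat.dvd_of_mod_eq_zero h
        have hk1 : k < 2 := by
          by_contra! h2
          nlinarith
        interval_cases k <;> lia
  rw [atypical, sum_filter, sum_product_right, sum_product_right]
  refine sum_congr rfl fun ω _ => ?_
  rw [range_eq_Ico, sum_eq_sum_Ico_succ_bot hN, ← range_eq_Ico]
  exact congrArg₂ (· + ·) (sum_congr rfl fun θ _ => if_pos (Or.inl rfl))
    (sum_congr rfl fun y hy => row y hy ω)

theorem sum_Ico_one_sub {M : Type*} [AddCommMonoid M] (N : ℕ) (g : ℕ → M) :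
    ∑ θ ∈ Ico 1 N, g (N - θ) = ∑ θ ∈ Ico 1 N, g θ := by
  refine sum_nbij' (fun θ => N - θ) (fun θ => N - θ) ?_ ?_ ?_ ?_ ?_ <;>
    intro θ h <;> simp only [mem_Ico] at * <;> lia

/-- With the atypical weights `Λ` and constants `d_λ` as above (the atypical
irreducible `U_q^{(r)}(gl(2|1))`-modules having `q`-superdimension `1` and
ribbon eigenvalue `χ_λ(v) = q^{-λ₃²}`), the normalization constant
`z = Σ_{λ∈Λ} d_λ·q^{-λ₃²}` equals `G_{N-1}²/N`, for `N = 2r+1`,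
`q = exp(2πi/N)`, and any family `a(θ,ω)` satisfying the two defining
conditions. -/
theorem z_value_gl21 (r : ℕ) (hr : 1 ≤ r) (a : ℕ → ℕ → ℂ)
    (ha₁ : ∀ ω < 2 * r + 1, a 0 ω = a 0 ((2 * r + 1 - ω) % (2 * r + 1)))
    (ha₂ : ∀ ω < 2 * r + 1,
      (1 / (2 * r + 1 : ℂ)) * qRoot (2 * r + 1) ^ ((ω : ℤ) ^ 2) *
          gauss (2 * r + 1) ((2 * r + 1 : ℤ) - 1)
        = a 0 ω + ∑ θ ∈ Finset.Ico 1 (2 * r + 1),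
            (a θ ω + a (2 * r + 1 - θ) ((2 * r + 1 - ω) % (2 * r + 1)))) :
    ∑ lam ∈ atypical (2 * r + 1),
        dGl21 (2 * r + 1) a lam * qRoot (2 * r + 1) ^ (-((lam.2.2 : ℤ)) ^ 2)
      = (gauss (2 * r + 1) ((2 * r + 1 : ℤ) - 1)) ^ 2 / (2 * r + 1 : ℂ) := by
  have h_pos : 0 < 2 * r + 1 := by lia
  have h_gauss : gauss (2 * r + 1) ((2 * r + 1 : ℤ) - 1)
      = ∑ ω ∈ range (2 * r + 1), qRoot (2 * r + 1) ^ (-((ω : ℤ) ^ 2)) :=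
    sum_congr rfl fun ω _ => by
      simpa using qRoot_zpow_sub_one_mul h_pos.ne' ((ω : ℤ) ^ 2)
  rw [sum_atypical h_pos]
  trans ∑ ω ∈ range (2 * r + 1), qRoot (2 * r + 1) ^ (-((ω : ℤ) ^ 2)) *
    (gauss (2 * r + 1) ((2 * r + 1 : ℤ) - 1) / (2 * r + 1 : ℂ))
  · refine sum_congr rfl fun ω hω => ?_
    have h := ha₂ ω (mem_range.1 hω)
    rw [sum_add_distrib,
      sum_Ico_one_sub _ fun θ => a θ ((2 * r + 1 - ω) % (2 * r + 1))] at h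
    set c := qRoot (2 * r + 1) ^ (-((ω : ℤ) ^ 2)) with hc
    have h_inv : c * qRoot (2 * r + 1) ^ ((ω : ℤ) ^ 2) = 1 := by
      rw [hc, ← zpow_add₀ (qRoot_ne_zero _), neg_add_cancel, zpow_zero]
    have h₀ : ∑ θ ∈ range (2 * r + 1), dGl21 (2 * r + 1) a (θ, 0, ω) * c
        = c * c * (a 0 ω + ∑ θ ∈ Ico 1 (2 * r + 1), a θ ω) := by
      rw [← sum_eq_sum_Ico_succ_bot h_pos fun θ => a θ ω, ← range_eq_Ico, mul_sum]
      refine sum_congr rfl fun θ _ => ?_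
      simp only [dGl21, if_true, ← hc]
      ring
    have h₁ : ∑ θ ∈ Ico 1 (2 * r + 1),
          dGl21 (2 * r + 1) a (2 * r + 1 - 1 - θ, θ, ω) * c
        = c * c * ∑ θ ∈ Ico 1 (2 * r + 1), a θ ((2 * r + 1 - ω) % (2 * r + 1)) := by
      rw [mul_sum]
      refine sum_congr rfl fun θ hθ => ?_
      have hθ₀ : θ ≠ 0 := by
        rw [mem_Ico] at hθ
        lia
      simp only [dGl21, if_neg hθ₀, ← hc]
      ring
    rw [h₀, h₁, ← mul_add, add_assoc, ← h]
    linear_combination (c * gauss (2 * r + 1) ((2 * r + 1 : ℤ) - 1) / (2 * r + 1 : ℂ)) * h_inv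
  · rw [← sum_mul, ← h_gauss]
    ring

end
end
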